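/- Let C be a covering of a finite set E. The family {I(x) : x ∈ E} forms a partition of E if and only if C satisfies the (TRA) condition: for all x, y, z ∈ E, if there exist K_1 ∈ C with x, z ∈ K_1 and K_2 ∈ C with y, z ∈ K_2, then there exists K_3 ∈ C with x, y ∈ K_3. -/

import Mathlib

variable {α : Type*}

/-- `C` is a covering of the (finite) universe: a finite family of nonempty
subsets whose union is everything. -/
def IsCovering [Fintype α] (C : Finset (Set α)) : Prop :=
  (∀ K ∈ C, K.Nonempty) ∧ ⋃₀ (C : Set (Set α)) = Set.univ

/-- The indiscernible neighborhood of `x`: `I(x) = ⋃ {K ∈ C : x ∈ K}`. -/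
def indNbhd (C : Finset (Set α)) (x : α) : Set α :=
  ⋃₀ {K | K ∈ C ∧ x ∈ K}

theorem mem_indNbhd {C : Finset (Set α)} {x z : α} :
    z ∈ indNbhd C x ↔ ∃ K ∈ C, x ∈ K ∧ z ∈ K := by
  simp [indNbhd, and_assoc]

theorem mem_indNbhd_comm {C : Finset (Set α)} {x z : α} :
    z ∈ indNbhd C x ↔ x ∈ indNbhd C z := by
  simp only [mem_indNbhd, and_comm]

theorem IsCovering.mem_indNbhd_self [Fintype α] {C : Finset (Set α)} (hC : IsCovering C)
    (x : α) : x ∈ indNbhd C x := by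
  obtain ⟨K, hK, hx⟩ : x ∈ ⋃₀ (C : Set (Set α)) := hC.2 ▸ Set.mem_univ x
  exact mem_indNbhd.2 ⟨K, hK, hx, hx⟩

/-- for a covering `C` of a finite set `E`, the family
`{I(x) : x ∈ E}` forms a partition of `E` iff `C` satisfies the (TRA)
condition: whenever some block contains `x, z` and some block contains
`y, z`, some block contains `x, y`. -/
theorem stmt15 [Fintype α] (C : Finset (Set α)) (hC : IsCovering C) :
    (∀ x y : α, indNbhd C x = indNbhd C y ∨ indNbhd C x ∩ indNbhd C y = ∅) ↔
      ∀ x y z : α, (∃ K₁ ∈ C, x ∈ K₁ ∧ z ∈ K₁) → (∃ K₂ ∈ C, y ∈ K₂ ∧ z ∈ K₂) →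
        ∃ K₃ ∈ C, x ∈ K₃ ∧ y ∈ K₃ := by
  simp only [← mem_indNbhd]
  constructor
  · intro h x y z hxz hyz
    rcases h x y with hxy | hxy
    · exact hxy ▸ hC.mem_indNbhd_self y
    · exact (Set.eq_empty_iff_forall_notMem.1 hxy z ⟨hxz, hyz⟩).elim
  · intro h x y
    refine or_iff_not_imp_right.2 fun hxy => ?_
    obtain ⟨z, hxz, hyz⟩ := Set.nonempty_iff_ne_empty.2 hxy
    have hyx : y ∈ indNbhd C x := h x y z hxz hyz
    ext w
    exact ⟨fun hw => h y w x (mem_indNbhd_comm.1 hyx) (mem_indNbhd_comm.1 hw),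
      fun hw => h x w y hyx (mem_indNbhd_comm.1 hw)⟩
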